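/- L^p-Euclidean logarithmic Sobolev inequality in optimal scaled form: Let p > 1, q = p/(p-1), n ≥ 1, and let g : ℝⁿ → (0,∞) be a C¹ function with ∫ g^p dx = 1 and ∫ |∇g|^p dx < ∞. Then ∫_{ℝⁿ} g^p log(g^p) dx ≤ (n/p) log( p^p γ_{n,p}^{-1} ∫_{ℝⁿ} |∇g|^p dx ), where γ_{n,p} = n (q e)^{p-1} π^{p/2} [ Γ(n/2+1)/Γ(n/q+1) ]^{-p/n}. -/

import Mathlib

open MeasureTheory

/-- The sharp constant `γ_{n,p} = n (q e)^{p-1} π^{p/2} (Γ(n/2+1)/Γ(n/q+1))^{-p/n}`. -/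
noncomputable def gammaConst (n : ℕ) (p q : ℝ) : ℝ :=
  (n : ℝ) * (q * Real.exp 1) ^ (p - 1) * Real.pi ^ (p / 2) *
    (Real.Gamma ((n : ℝ) / 2 + 1) / Real.Gamma ((n : ℝ) / q + 1)) ^ (-(p / (n : ℝ)))

theorem volume_add_volume_le_of_add_subset {A B S : Set ℝ} (hA : MeasurableSet A)
    (hB : MeasurableSet B) (hA' : A.Nonempty) (hB' : B.Nonempty)
    (h : ∀ x ∈ A, ∀ y ∈ B, x + y ∈ S) : volume A + volume B ≤ volume S := by
  obtain ⟨a, ha⟩ := hA'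
  obtain ⟨b, hb⟩ := hB'
  have key : ∀ K ⊆ A, IsCompact K → ∀ L ⊆ B, IsCompact L →
      volume K + volume L ≤ volume S := by
    intro K hKA hK L hLB hL
    obtain ⟨k, hk, hkmax⟩ := (hK.insert a).exists_isGreatest ⟨a, Set.mem_insert a K⟩
    obtain ⟨l, hl, hlmin⟩ := (hL.insert b).exists_isLeast ⟨b, Set.mem_insert b L⟩
    have hkA : k ∈ A := Set.insert_subset ha hKA hk
    have hlB : l ∈ B := Set.insert_subset hb hLB hl
    have hdisj : AEDisjoint volume ((fun x => x + l) '' K) ((fun x => x + k) '' L) := by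
      refine measure_mono_null (t := {k + l}) ?_ (by simp)
      rintro _ ⟨⟨x, hx, rfl⟩, ⟨y, hy, hxy⟩⟩
      have h1 := hkmax (Set.mem_insert_of_mem a hx)
      have h2 := hlmin (Set.mem_insert_of_mem b hy)
      simp only [Set.mem_singleton_iff]
      simp only at hxy
      linarith
    have hLm : MeasurableSet ((fun x => x + k) '' L) :=
      (hL.image (by fun_prop)).measurableSet
    calc volume K + volume L
        = volume ((fun x => x + l) '' K) + volume ((fun x => x + k) '' L) := by
          simp [Set.image_add_right]
      _ = volume ((fun x => x + l) '' K ∪ (fun x => x + k) '' L) :=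
          (measure_union₀ hLm.nullMeasurableSet hdisj).symm
      _ ≤ volume S := by
          refine measure_mono (Set.union_subset ?_ ?_)
          · rintro _ ⟨x, hx, rfl⟩
            exact h x (hKA hx) l hlB
          · rintro _ ⟨y, hy, rfl⟩
            simpa [add_comm] using h k hkA y (hLB hy)
  rw [hA.measure_eq_iSup_isCompact, hB.measure_eq_iSup_isCompact]
  simp only [iSup_and']
  exact ENNReal.biSup_add_biSup_le' ⟨∅, by simp⟩ ⟨∅, by simp⟩
    fun K hK L hL => key K hK.1 hK.2 L hL.1 hL.2

theorem lintegral_add_lintegral_le_of_superlevel {u v h : ℝ → ℝ} (hu : Measurable u)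
    (hv : Measurable v) (hh : Measurable h) (hu0 : ∀ x, 0 ≤ u x) (hv0 : ∀ x, 0 ≤ v x)
    (hh0 : ∀ x, 0 ≤ h x) (hu1 : ∀ x, u x ≤ 1) (hv1 : ∀ x, v x ≤ 1)
    (hus : ∀ t < 1, ∃ x, t < u x) (hvs : ∀ t < 1, ∃ x, t < v x)
    (H : ∀ t x y, 0 ≤ t → t < u x → t < v y → t < h (x + y)) :
    (∫⁻ x, ENNReal.ofReal (u x)) + ∫⁻ x, ENNReal.ofReal (v x) ≤ ∫⁻ x, ENNReal.ofReal (h x) := by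
  rw [lintegral_eq_lintegral_meas_lt volume (.of_forall hu0) hu.aemeasurable,
    lintegral_eq_lintegral_meas_lt volume (.of_forall hv0) hv.aemeasurable,
    lintegral_eq_lintegral_meas_lt volume (.of_forall hh0) hh.aemeasurable,
    ← lintegral_add_left']
  · refine setLIntegral_mono' measurableSet_Ioi fun t ht => ?_
    have ht0 : 0 < t := ht
    rcases lt_or_ge t 1 with h1 | h1
    · exact volume_add_volume_le_of_add_subset (measurableSet_lt measurable_const hu)
        (measurableSet_lt measurable_const hv) (hus t h1) (hvs t h1)
        fun x hx y hy => H t x y ht0.le hx hy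
    · have e1 : {a | t < u a} = ∅ := by
        ext x; simpa using (hu1 x).trans h1
      have e2 : {a | t < v a} = ∅ := by
        ext x; simpa using (hv1 x).trans h1
      simp [e1, e2]
  · exact (Antitone.measurable fun s t hst =>
      measure_mono fun x (hx : t < u x) => hst.trans_lt hx).aemeasurable

theorem ENNReal.geom_mean_le_add {a b : ℝ} (ha : 0 < a) (hb : 0 < b) (hab : a + b = 1)
    (x y : ENNReal) : x ^ a * y ^ b ≤ ENNReal.ofReal (a ^ a * b ^ b) * (x + y) := by
  have hc : (a⁻¹).HolderConjugate b⁻¹ := by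
    rw [Real.holderConjugate_iff]
    refine ⟨(one_lt_inv₀ ha).2 (by linarith), by simpa using hab⟩
  have e : ∀ {a : ℝ}, 0 < a → ∀ x : ENNReal,
      x ^ a = ENNReal.ofReal (a ^ a) * (x / ENNReal.ofReal a) ^ a := by
    intro a ha x
    rw [← ENNReal.ofReal_rpow_of_pos ha, ← ENNReal.mul_rpow_of_nonneg _ _ ha.le,
      ENNReal.mul_div_cancel (by simpa) (by simp)]
  have y1 := ENNReal.young_inequality ((x / ENNReal.ofReal a) ^ a) ((y / ENNReal.ofReal b) ^ b) hc
  have e2 : ∀ {a : ℝ}, 0 < a → ∀ x : ENNReal,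
      ((x / ENNReal.ofReal a) ^ a) ^ a⁻¹ / ENNReal.ofReal a⁻¹ = x := by
    intro a ha x
    rw [ENNReal.rpow_rpow_inv ha.ne', ENNReal.ofReal_inv_of_pos ha, div_eq_mul_inv, inv_inv,
      ENNReal.div_mul_cancel (by simpa) (by simp)]
  rw [e2 ha, e2 hb] at y1
  rw [e ha x, e hb y, ENNReal.ofReal_mul (by positivity), mul_mul_mul_comm]
  gcongr

theorem prekopa_leindler_real_of_bounded {a b : ℝ} (ha : 0 < a) (hb : 0 < b) (hab : a + b = 1)
    {u v h : ℝ → ENNReal} (hu : Measurable u) (hv : Measurable v) (hh : Measurable h)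
    (hub : ⨆ x, u x ≠ ⊤) (hvb : ⨆ x, v x ≠ ⊤)
    (H : ∀ x y, u x ^ a * v y ^ b ≤ h (x + y)) :
    (∫⁻ x, u x) ^ a * (∫⁻ x, v x) ^ b ≤ ENNReal.ofReal (a ^ a * b ^ b) * ∫⁻ x, h x := by
  have normalized : ∀ w : ℝ → ENNReal, Measurable w → ⨆ x, w x ≠ ⊤ → ⨆ x, w x ≠ 0 →
      (∀ x, w x / (⨆ x, w x) ≤ 1) ∧
      (∀ t < 1, ∃ x, t < (w x / (⨆ x, w x)).toReal) ∧
      ∫⁻ x, w x = (⨆ x, w x) * ∫⁻ x, ENNReal.ofReal (w x / (⨆ x, w x)).toReal := by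
    intro w hw hwt hw0
    set M := ⨆ x, w x with hM
    have hle : ∀ x, w x / M ≤ 1 := fun x => ENNReal.div_le_of_le_mul (by simpa using le_iSup w x)
    have hne : ∀ x, w x / M ≠ ⊤ := fun x => ((hle x).trans_lt ENNReal.one_lt_top).ne
    refine ⟨hle, fun t ht => ?_, ?_⟩
    · have h1 : ENNReal.ofReal t * M < M := by
        calc ENNReal.ofReal t * M < 1 * M :=
              (ENNReal.mul_lt_mul_iff_left hw0 hwt).2 (by simpa using ht)
          _ = M := one_mul _
      obtain ⟨x, hx⟩ := lt_iSup_iff.1 (hM ▸ h1)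
      refine ⟨x, ?_⟩
      have h2 : ENNReal.ofReal t < w x / M :=
        (ENNReal.lt_div_iff_mul_lt (.inl hw0) (.inl hwt)).2 hx
      rcases lt_or_ge t 0 with h0 | h0
      · exact h0.trans_le ENNReal.toReal_nonneg
      · exact (ENNReal.ofReal_lt_iff_lt_toReal h0 (hne x)).1 h2
    · rw [← lintegral_const_mul _ (by fun_prop)]
      refine lintegral_congr fun x => ?_
      rw [ENNReal.ofReal_toReal (hne x), ENNReal.mul_div_cancel hw0 hwt]
  by_cases hM0 : ⨆ x, u x = 0
  · have : ∀ x, u x = 0 := by simpa using hM0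
    simp [this, ha]
  by_cases hN0 : ⨆ x, v x = 0
  · have : ∀ x, v x = 0 := by simpa using hN0
    simp [this, hb]
  obtain ⟨hu1, hus, hui⟩ := normalized u hu hub hM0
  obtain ⟨hv1, hvs, hvi⟩ := normalized v hv hvb hN0
  set M := ⨆ x, u x
  set N := ⨆ x, v x
  set D := M ^ a * N ^ b with hD
  have hD0 : D ≠ 0 := by simp [hD, hM0, hN0, hub, hvb]
  have hDt : D ≠ ⊤ := ENNReal.mul_ne_top (by simp [hub, ha.le]) (by simp [hvb, hb.le])
  have hUH : ∀ x y, (u x / M) ^ a * (v y / N) ^ b ≤ min 1 (h (x + y) / D) := by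
    intro x y
    refine le_min ?_ ?_
    · exact mul_le_one' (ENNReal.rpow_le_one (hu1 x) ha.le) (ENNReal.rpow_le_one (hv1 y) hb.le)
    · rw [ENNReal.div_rpow_of_nonneg _ _ ha.le, ENNReal.div_rpow_of_nonneg _ _ hb.le,
        ENNReal.le_div_iff_mul_le (.inl hD0) (.inl hDt)]
      refine le_trans (le_of_eq ?_) (H x y)
      have e1 : u x ^ a / M ^ a * M ^ a = u x ^ a :=
        ENNReal.div_mul_cancel (by simp [hM0, hub]) (by simp [hub, ha.le])
      have e2 : v y ^ b / N ^ b * N ^ b = v y ^ b :=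
        ENNReal.div_mul_cancel (by simp [hN0, hvb]) (by simp [hvb, hb.le])
      rw [hD, mul_mul_mul_comm, e1, e2]
  have hsum := lintegral_add_lintegral_le_of_superlevel
    (u := fun x => (u x / M).toReal) (v := fun x => (v x / N).toReal)
    (h := fun x => (min 1 (h x / D)).toReal)
    (by fun_prop) (by fun_prop) (by fun_prop) (fun _ => ENNReal.toReal_nonneg)
    (fun _ => ENNReal.toReal_nonneg) (fun _ => ENNReal.toReal_nonneg)
    (fun x => ENNReal.toReal_le_of_le_ofReal zero_le_one (by simpa using hu1 x))
    (fun x => ENNReal.toReal_le_of_le_ofReal zero_le_one (by simpa using hv1 x)) hus hvs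
    (by
      intro t x y ht hx hy
      calc t = t ^ a * t ^ b := by
            rw [← Real.rpow_add_of_nonneg ht ha.le hb.le, hab, Real.rpow_one]
        _ < (u x / M).toReal ^ a * (v y / N).toReal ^ b :=
            mul_lt_mul'' (Real.rpow_lt_rpow ht hx ha) (Real.rpow_lt_rpow ht hy hb)
              (by positivity) (by positivity)
        _ = ((u x / M) ^ a * (v y / N) ^ b).toReal := by
            rw [ENNReal.toReal_mul, ENNReal.toReal_rpow, ENNReal.toReal_rpow]
        _ ≤ _ := ENNReal.toReal_mono (by simp) (hUH x y))
  rw [hui, hvi, ENNReal.mul_rpow_of_nonneg _ _ ha.le, ENNReal.mul_rpow_of_nonneg _ _ hb.le,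
    mul_mul_mul_comm]
  calc D * _ ≤ D * (ENNReal.ofReal (a ^ a * b ^ b) *
        ∫⁻ x, ENNReal.ofReal (min 1 (h x / D)).toReal) := by
        refine mul_le_mul_right ((ENNReal.geom_mean_le_add ha hb hab _ _).trans ?_) D
        exact mul_le_mul_right hsum _
    _ = ENNReal.ofReal (a ^ a * b ^ b) *
        ∫⁻ x, D * ENNReal.ofReal (min 1 (h x / D)).toReal := by
        rw [lintegral_const_mul _ (by fun_prop)]; ring
    _ ≤ _ := by
        gcongr with x
        rw [ENNReal.ofReal_toReal (by simp)]
        calc D * min 1 (h x / D) ≤ D * (h x / D) := by gcongr; exact min_le_right _ _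
          _ = h x := ENNReal.mul_div_cancel hD0 hDt

theorem lintegral_eq_iSup_min_natCast {α : Type*} [MeasurableSpace α] (μ : Measure α)
    {u : α → ENNReal} (hu : Measurable u) :
    ∫⁻ x, u x ∂μ = ⨆ k : ℕ, ∫⁻ x, min (u x) k ∂μ := by
  rw [← lintegral_iSup (fun k => by fun_prop)]
  · refine lintegral_congr fun x => ?_
    rw [← inf_iSup_eq, ENNReal.iSup_natCast, inf_top_eq]
  · intro i j hij x
    exact min_le_min le_rfl (by exact_mod_cast hij)

theorem ENNReal.iSup_rpow {ι : Type*} [Nonempty ι] (f : ι → ENNReal) {a : ℝ} (ha : 0 < a) :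
    (⨆ i, f i) ^ a = ⨆ i, f i ^ a := by
  exact (ENNReal.orderIsoRpow a ha).map_iSup f

theorem prekopa_leindler_real {a b : ℝ} (ha : 0 < a) (hb : 0 < b) (hab : a + b = 1)
    {u v h : ℝ → ENNReal} (hu : Measurable u) (hv : Measurable v) (hh : Measurable h)
    (H : ∀ x y, u x ^ a * v y ^ b ≤ h (x + y)) :
    (∫⁻ x, u x) ^ a * (∫⁻ x, v x) ^ b ≤ ENNReal.ofReal (a ^ a * b ^ b) * ∫⁻ x, h x := by
  rw [lintegral_eq_iSup_min_natCast _ hu, lintegral_eq_iSup_min_natCast _ hv,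
    ENNReal.iSup_rpow _ ha, ENNReal.iSup_rpow _ hb, ENNReal.iSup_mul]
  simp only [ENNReal.mul_iSup, iSup_le_iff]
  intro k l
  have hfin : ∀ (w : ℝ → ENNReal) (k : ℕ), ⨆ x, min (w x) k ≠ ⊤ := fun w k =>
    ((iSup_le fun x => min_le_right _ _).trans_lt (ENNReal.natCast_lt_top k)).ne
  refine prekopa_leindler_real_of_bounded ha hb hab (by fun_prop) (by fun_prop) hh
    (hfin u k) (hfin v l) fun x y => le_trans ?_ (H x y)
  gcongr <;> exact min_le_left _ _

theorem prekopa_leindler_pi {a b : ℝ} (ha : 0 < a) (hb : 0 < b) (hab : a + b = 1) (n : ℕ) :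
    ∀ {u v h : (Fin n → ℝ) → ENNReal}, Measurable u → Measurable v → Measurable h →
    (∀ x y, u x ^ a * v y ^ b ≤ h (x + y)) →
    (∫⁻ x, u x) ^ a * (∫⁻ x, v x) ^ b ≤ ENNReal.ofReal (a ^ a * b ^ b) ^ n * ∫⁻ x, h x := by
  induction n with
  | zero =>
    intro u v h hu hv hh H
    have h0 := H 0 0
    rw [add_zero] at h0
    rwa [Measure.volume_pi_eq_dirac (0 : Fin 0 → ℝ), lintegral_dirac' _ hu, lintegral_dirac' _ hv,
      lintegral_dirac' _ hh, pow_zero, one_mul]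
  | succ n ih =>
    intro u v h hu hv hh H
    set κ := ENNReal.ofReal (a ^ a * b ^ b)
    have hmp := (volume_preserving_piFinSuccAbove (fun _ : Fin (n + 1) => ℝ) 0).symm
    set e := (MeasurableEquiv.piFinSuccAbove (fun _ : Fin (n + 1) => ℝ) 0).symm
    have hadd : ∀ (s t : ℝ) (x y : Fin n → ℝ), e (s, x) + e (t, y) = e (s + t, x + y) := by
      intro s t x y
      ext i
      refine Fin.cases ?_ (fun j => ?_) i <;> simp [e, MeasurableEquiv.piFinSuccAbove]
    have lintegral_eq : ∀ w : (Fin (n + 1) → ℝ) → ENNReal, Measurable w →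
        ∫⁻ x, w x = ∫⁻ s : ℝ, ∫⁻ x : Fin n → ℝ, w (e (s, x)) := by
      intro w hw
      rw [← hmp.lintegral_comp hw, Measure.volume_eq_prod,
        lintegral_prod (fun z => w (e z)) (hw.comp e.measurable).aemeasurable]
    have hmeas : ∀ w : (Fin (n + 1) → ℝ) → ENNReal, Measurable w →
        Measurable fun s : ℝ => ∫⁻ x : Fin n → ℝ, w (e (s, x)) := by
      intro w hw
      exact Measurable.lintegral_prod_right' (f := fun z => w (e z)) (by fun_prop)
    rw [lintegral_eq u hu, lintegral_eq v hv, lintegral_eq h hh, pow_succ', mul_assoc,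
      ← lintegral_const_mul _ (hmeas h hh)]
    refine prekopa_leindler_real ha hb hab (hmeas u hu) (hmeas v hv)
      ((hmeas h hh).const_mul _) fun s t => ?_
    refine ih (by fun_prop) (by fun_prop) (by fun_prop) fun x y => ?_
    rw [← hadd]
    exact H _ _

theorem prekopa_leindler {a b : ℝ} (ha : 0 < a) (hb : 0 < b) (hab : a + b = 1) {n : ℕ}
    {u v h : EuclideanSpace ℝ (Fin n) → ENNReal} (hu : Measurable u) (hv : Measurable v)
    (hh : Measurable h) (H : ∀ x y, u x ^ a * v y ^ b ≤ h (x + y)) :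
    (∫⁻ x, u x) ^ a * (∫⁻ x, v x) ^ b ≤ ENNReal.ofReal (a ^ a * b ^ b) ^ n * ∫⁻ x, h x := by
  have hmp := PiLp.volume_preserving_toLp (Fin n)
  have lintegral_eq : ∀ w : EuclideanSpace ℝ (Fin n) → ENNReal, Measurable w →
      ∫⁻ x, w x = ∫⁻ x, w (WithLp.toLp 2 x) := fun w hw => (hmp.lintegral_comp hw).symm
  rw [lintegral_eq u hu, lintegral_eq v hv, lintegral_eq h hh]
  refine prekopa_leindler_pi ha hb hab n (hu.comp hmp.measurable) (hv.comp hmp.measurable)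
    (hh.comp hmp.measurable) fun x y => ?_
  exact H _ _

theorem Real.add_mul_rpow_le_mul_exp {p q : ℝ} (hpq : p.HolderConjugate q) {a G r κ : ℝ}
    (ha : 0 ≤ a) (hG : 0 ≤ G) (hr : 0 ≤ r) (hκ : 0 < κ) :
    (a + G * r) ^ p ≤ (a ^ p + κ * G ^ p) * Real.exp ((p - 1) * κ ^ (1 - q) * r ^ q) := by
  have hp := hpq.pos
  have hq := hpq.symm.pos
  have hκp : 0 < κ ^ (1 / p) := Real.rpow_pos_of_pos hκ _
  have hmul : κ ^ (1 / p) * κ ^ (-(1 / p)) = 1 := by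
    rw [← Real.rpow_add hκ]; simp
  have hs0 : 0 ≤ κ ^ (-(1 / p)) * r := by positivity
  have hX : 0 ≤ a ^ p + κ * G ^ p := by positivity
  set Y := κ ^ (1 - q) * r ^ q with hY
  have hY0 : 0 ≤ Y := by positivity
  have holder := Real.inner_le_Lp_mul_Lq_of_nonneg (s := Finset.univ)
    (f := ![a, κ ^ (1 / p) * G]) (g := ![1, κ ^ (-(1 / p)) * r]) hpq
    (by intro i _; fin_cases i <;> simp [ha]; positivity)
    (by intro i _; fin_cases i <;> simp; positivity)
  simp only [Fin.sum_univ_two, Matrix.cons_val_zero, Matrix.cons_val_one, mul_one,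
    Real.one_rpow] at holder
  have e1 : κ ^ (1 / p) * G * (κ ^ (-(1 / p)) * r) = G * r := by
    linear_combination G * r * hmul
  have e2 : (κ ^ (1 / p) * G) ^ p = κ * G ^ p := by
    rw [Real.mul_rpow hκp.le hG, ← Real.rpow_mul hκ.le, one_div_mul_cancel hp.ne', Real.rpow_one]
  have e3 : (κ ^ (-(1 / p)) * r) ^ q = Y := by
    rw [Real.mul_rpow (by positivity) hr, ← Real.rpow_mul hκ.le, hY]
    congr 2
    have := hpq.sub_one_mul_conj
    field_simp
    linarith
  rw [e1, e2, e3] at holder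
  have e4 : 1 / q * p = p - 1 := by
    have := hpq.sub_one_mul_conj
    field_simp
    linarith
  calc (a + G * r) ^ p
      ≤ ((a ^ p + κ * G ^ p) ^ (1 / p) * (1 + Y) ^ (1 / q)) ^ p :=
        Real.rpow_le_rpow (by positivity) holder hp.le
    _ = (a ^ p + κ * G ^ p) * (1 + Y) ^ (p - 1) := by
        rw [Real.mul_rpow (by positivity) (by positivity), ← Real.rpow_mul hX,
          ← Real.rpow_mul (by positivity), one_div_mul_cancel hp.ne', Real.rpow_one, e4]
    _ ≤ (a ^ p + κ * G ^ p) * Real.exp Y ^ (p - 1) := by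
        gcongr
        · exact hpq.sub_one_pos.le
        · linarith [Real.add_one_le_exp Y]
    _ = _ := by
        rw [← Real.exp_mul, hY]
        ring_nf

theorem mul_exp_le_integral_rpow {α : Type*} [MeasurableSpace α] {μ : Measure α} {f : α → ℝ}
    (hf0 : ∀ x, 0 ≤ f x) (hf : Integrable f μ) (hfl : Integrable (fun x => f x * Real.log (f x)) μ)
    {s : ℝ} (hs : 0 < s) (hfs : Integrable (fun x => f x ^ (1 + s)) μ) (hA : 0 < ∫ x, f x ∂μ) :
    (∫ x, f x ∂μ) * Real.exp (s * ((∫ x, f x * Real.log (f x) ∂μ) / ∫ x, f x ∂μ)) ≤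
      ∫ x, f x ^ (1 + s) ∂μ := by
  set A := ∫ x, f x ∂μ
  set m := (∫ x, f x * Real.log (f x) ∂μ) / A with hm
  have hmA : ∫ x, f x * Real.log (f x) ∂μ = m * A := by rw [hm, div_mul_cancel₀ _ hA.ne']
  have hpt : ∀ x, Real.exp (s * m) * (f x * (1 - s * m) + s * (f x * Real.log (f x))) ≤
      f x ^ (1 + s) := by
    intro x
    rcases (hf0 x).eq_or_lt with h0 | h0
    · rw [← h0, Real.zero_rpow (by positivity)]; simp
    · have h1 := Real.add_one_le_exp (s * Real.log (f x) - s * m)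
      have h2 : f x ^ (1 + s) =
          Real.exp (s * m) * (f x * Real.exp (s * Real.log (f x) - s * m)) := by
        rw [Real.rpow_add h0, Real.rpow_one, Real.rpow_def_of_pos h0, mul_left_comm,
          ← Real.exp_add]
        ring_nf
      rw [h2]
      have h3 : f x * (1 - s * m) + s * (f x * Real.log (f x)) =
        f x * (s * Real.log (f x) - s * m + 1) := by ring
      rw [h3]
      gcongr
  have := integral_mono (((hf.mul_const _).add (hfl.const_mul s)).const_mul _) hfs hpt
  refine le_trans (le_of_eq ?_) this
  simp only [Pi.add_apply]
  rw [integral_const_mul, integral_add (hf.mul_const _) (hfl.const_mul s), integral_mul_const,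
    integral_const_mul, hmA]
  ring

theorem add_log_le_of_rpow_mul_rpow_le {n : ℕ} {A Z T l m : ℝ} (hA : 0 < A) (hZ : 0 < Z)
    (hT : 0 ≤ T) (hl0 : 0 < l) (hl1 : l < 1)
    (h : (A * Real.exp (l / (1 - l) * m)) ^ (1 - l) * (l ^ n * Z) ^ l ≤
      ((1 - l) ^ (1 - l) * l ^ l) ^ n * (A + l * T)) :
    m + Real.log Z + n * (1 - l) ≤ Real.log A + T / A := by
  have h1l : 0 < 1 - l := by linarith
  have hlog := Real.log_le_log (by positivity) h
  rw [Real.log_mul (by positivity) (by positivity), Real.log_mul (by positivity) (by positivity),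
    Real.log_rpow (by positivity), Real.log_rpow (by positivity), Real.log_pow,
    Real.log_mul (by positivity) (by positivity), Real.log_mul (by positivity) (by positivity),
    Real.log_mul (by positivity) (by positivity), Real.log_rpow h1l, Real.log_rpow hl0,
    Real.log_exp, Real.log_pow] at hlog
  have e1 : (1 - l) * (Real.log A + l / (1 - l) * m) = (1 - l) * Real.log A + l * m := by
    field_simp
  have h2 : Real.log (1 - l) ≤ -l := by linarith [Real.log_le_sub_one_of_pos h1l]
  have h3 : Real.log (A + l * T) ≤ Real.log A + l * (T / A) := by
    have : A + l * T = A * (1 + l * (T / A)) := by field_simp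
    rw [this, Real.log_mul hA.ne' (by positivity)]
    linarith [Real.log_le_sub_one_of_pos (show 0 < 1 + l * (T / A) by positivity)]
  have h4 : (n : ℝ) * ((1 - l) * Real.log (1 - l)) ≤ n * ((1 - l) * -l) := by gcongr
  rw [e1] at hlog
  have h5 : l * (m + Real.log Z + n * (1 - l)) ≤ l * (Real.log A + T / A) := by
    nlinarith
  exact le_of_mul_le_mul_left h5 hl0

theorem lintegral_comp_inv_smul {n : ℕ} (f : EuclideanSpace ℝ (Fin n) → ENNReal)
    (hf : Measurable f) {l : ℝ} (hl : 0 < l) :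
    ∫⁻ y, f (l⁻¹ • y) = ENNReal.ofReal (l ^ n) * ∫⁻ y, f y := by
  have h := Measure.map_addHaar_smul (volume : Measure (EuclideanSpace ℝ (Fin n)))
    (inv_ne_zero hl.ne')
  rw [← lintegral_map hf (measurable_const_smul l⁻¹), h, lintegral_smul_measure]
  simp [abs_of_pos hl]

theorem entropy_le_of_local_slope {n : ℕ} {p q : ℝ} (hpq : p.HolderConjugate q)
    {g w : EuclideanSpace ℝ (Fin n) → ℝ} (hg : Continuous g) (hgs : HasCompactSupport g)
    (hg0 : ∀ x, 0 ≤ g x) (hw : Measurable w) (hwi : Integrable w) (hw0 : ∀ x, 0 ≤ w x)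
    (hA : 0 < ∫ x, g x ^ p) {c ρ l : ℝ} (hc : 0 < c) (hρ : 0 < ρ) (hl0 : 0 < l) (hl1 : l < 1)
    (hslope : ∀ z y, ‖y‖ ≤ l * ρ → g (z - y) ≤ g z + w z ^ (1 / p) * ‖y‖) :
    (∫ x, g x ^ p * Real.log (g x ^ p)) / (∫ x, g x ^ p) +
      Real.log (∫ y in Metric.closedBall (0 : EuclideanSpace ℝ (Fin n)) ρ,
        Real.exp (-((p - 1) * c ^ (1 - q) * ‖y‖ ^ q))) + n * (1 - l) ≤
      Real.log (∫ x, g x ^ p) + (c * ∫ x, w x) / ∫ x, g x ^ p := by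
  have hp := hpq.pos
  have hq := hpq.symm.pos
  have h1l : 0 < 1 - l := by linarith
  set B := Metric.closedBall (0 : EuclideanSpace ℝ (Fin n)) ρ
  set C := (p - 1) * c ^ (1 - q) with hC
  set k : EuclideanSpace ℝ (Fin n) → ℝ := fun y => Real.exp (-(C * ‖y‖ ^ q)) with hk
  have hkc : Continuous k := by
    have : Continuous fun y : EuclideanSpace ℝ (Fin n) => ‖y‖ ^ q :=
      continuous_norm.rpow_const fun _ => .inr hq.le
    fun_prop
  have hki : IntegrableOn k B :=
    hkc.continuousOn.integrableOn_compact (isCompact_closedBall _ _)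
  set f : EuclideanSpace ℝ (Fin n) → ℝ := fun x => g x ^ p with hf
  have hf0 : ∀ x, 0 ≤ f x := fun x => Real.rpow_nonneg (hg0 x) p
  have hfc : Continuous f := hg.rpow_const fun _ => .inr hp.le
  have hfs : HasCompactSupport f := hgs.comp_left (g := fun t => t ^ p) (Real.zero_rpow hp.ne')
  have hfi : Integrable f := hfc.integrable_of_hasCompactSupport hfs
  have hfli : Integrable fun x => f x * Real.log (f x) :=
    (Real.continuous_mul_log.comp hfc).integrable_of_hasCompactSupport
      (hfs.comp_left (g := fun t => t * Real.log t) (by simp))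
  have hs : 0 < l / (1 - l) := by positivity
  have hs1 : 1 + l / (1 - l) = (1 - l)⁻¹ := by field_simp; ring
  have hfpi : Integrable fun x => f x ^ (1 + l / (1 - l)) :=
    (hfc.rpow_const fun _ => .inr (by positivity)).integrable_of_hasCompactSupport
      (hfs.comp_left (g := fun t => t ^ (1 + l / (1 - l))) (Real.zero_rpow (by positivity)))
  have hZ : 0 < ∫ y in B, k y := by
    rw [setIntegral_pos_iff_support_of_nonneg_ae (.of_forall fun _ => (Real.exp_pos _).le) hki]
    have : Function.support k = Set.univ := by
      ext y; simp [hk, (Real.exp_pos _).ne']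
    rw [this, Set.univ_inter]
    exact Metric.measure_closedBall_pos _ _ hρ
  set V : EuclideanSpace ℝ (Fin n) → ENNReal := B.indicator fun y => ENNReal.ofReal (k y) with hV
  have hVm : Measurable V :=
    hkc.measurable.ennreal_ofReal.indicator Metric.isClosed_closedBall.measurableSet
  have PL := prekopa_leindler (n := n) h1l hl0 (by ring)
    (u := fun x => ENNReal.ofReal (f x ^ (1 + l / (1 - l))))
    (v := fun y => V (l⁻¹ • y)) (h := fun z => ENNReal.ofReal (f z + l * (c * w z)))
    (hfc.rpow_const fun _ => .inr (by positivity)).measurable.ennreal_ofReal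
    (hVm.comp (measurable_const_smul _))
    (hfc.measurable.add ((hw.const_mul c).const_mul l)).ennreal_ofReal (by
      intro x y
      by_cases hy : l⁻¹ • y ∈ B
      · have hyn : ‖y‖ ≤ l * ρ := by
          have : l⁻¹ * ‖y‖ ≤ ρ := by
            simpa [B, norm_smul, abs_of_pos hl0] using hy
          rwa [inv_mul_le_iff₀ hl0] at this
        simp only [hV, Set.indicator_of_mem hy]
        rw [ENNReal.ofReal_rpow_of_nonneg (Real.rpow_nonneg (hf0 x) _) h1l.le,
          ENNReal.ofReal_rpow_of_nonneg (Real.exp_pos _).le hl0.le,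
          ← ENNReal.ofReal_mul (Real.rpow_nonneg (Real.rpow_nonneg (hf0 x) _) _)]
        refine ENNReal.ofReal_le_ofReal ?_
        rw [← Real.rpow_mul (hf0 x), hs1, inv_mul_cancel₀ h1l.ne', Real.rpow_one]
        have h1 := hslope (x + y) y hyn
        rw [add_sub_cancel_right] at h1
        have h2 := Real.add_mul_rpow_le_mul_exp hpq (hg0 (x + y))
          (Real.rpow_nonneg (hw0 (x + y)) (1 / p)) (norm_nonneg y) (mul_pos hl0 hc)
        have h3 : (w (x + y) ^ (1 / p)) ^ p = w (x + y) := by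
          rw [← Real.rpow_mul (hw0 _), one_div_mul_cancel hp.ne', Real.rpow_one]
        have h4 : k (l⁻¹ • y) ^ l = Real.exp (-((p - 1) * (l * c) ^ (1 - q) * ‖y‖ ^ q)) := by
          rw [hk, ← Real.exp_mul, norm_smul, Real.norm_of_nonneg (by positivity),
            Real.mul_rpow (by positivity) (norm_nonneg _), Real.mul_rpow hl0.le hc.le, hC,
            Real.inv_rpow hl0.le, Real.rpow_sub hl0, Real.rpow_one]
          congr 1
          field_simp
        rw [h4, Real.exp_neg, ← div_eq_mul_inv, div_le_iff₀ (Real.exp_pos _)]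
        calc f x ≤ (g (x + y) + w (x + y) ^ (1 / p) * ‖y‖) ^ p :=
              Real.rpow_le_rpow (hg0 x) h1 hp.le
          _ ≤ _ := h2
          _ = _ := by rw [h3, mul_assoc l c]
      · simp [hV, Set.indicator_of_notMem hy, hl0])
  have hTi : Integrable fun z => l * (c * w z) := (hwi.const_mul c).const_mul l
  have hsi : Integrable fun z => f z + l * (c * w z) := hfi.add hTi
  rw [lintegral_comp_inv_smul V hVm hl0, hV,
    lintegral_indicator Metric.isClosed_closedBall.measurableSet,
    ← ofReal_integral_eq_lintegral_ofReal hfpi (.of_forall fun x => Real.rpow_nonneg (hf0 x) _),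
    ← ofReal_integral_eq_lintegral_ofReal hki (.of_forall fun _ => (Real.exp_pos _).le),
    ← ofReal_integral_eq_lintegral_ofReal hsi
      (.of_forall fun x => add_nonneg (hf0 x) (by have := hw0 x; positivity)),
    ← ENNReal.ofReal_mul (by positivity),
    ENNReal.ofReal_rpow_of_nonneg (integral_nonneg fun x => Real.rpow_nonneg (hf0 x) _) h1l.le,
    ENNReal.ofReal_rpow_of_nonneg (by positivity) hl0.le,
    ← ENNReal.ofReal_mul (Real.rpow_nonneg (integral_nonneg fun x => Real.rpow_nonneg (hf0 x) _) _),
    ← ENNReal.ofReal_pow (by positivity), ← ENNReal.ofReal_mul (by positivity),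
    ENNReal.ofReal_le_ofReal_iff (mul_nonneg (by positivity) (integral_nonneg fun x =>
      add_nonneg (hf0 x) (by have := hw0 x; positivity)))] at PL
  rw [integral_add hfi hTi, integral_const_mul, integral_const_mul] at PL
  refine add_log_le_of_rpow_mul_rpow_le hA hZ (mul_nonneg hc.le (integral_nonneg hw0)) hl0 hl1
    (le_trans ?_ PL)
  gcongr
  exact mul_exp_le_integral_rpow hf0 hfi hfli hs hfpi hA

theorem HasCompactSupport.exists_local_slope {E : Type*} [NormedAddCommGroup E] [NormedSpace ℝ E]
    {g : E → ℝ} (hg : ContDiff ℝ 1 g) (hgs : HasCompactSupport g) {p ε : ℝ} (hp : 0 < p)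
    (hε : 0 < ε) :
    ∃ δ > 0, ∀ z y, ‖y‖ ≤ δ → g (z - y) ≤ g z +
      (‖fderiv ℝ g z‖ ^ p + (Metric.cthickening 1 (tsupport g)).indicator (fun _ => ε) z) ^ (1 / p)
        * ‖y‖ := by
  have hφ : Continuous fun x => ‖fderiv ℝ g x‖ ^ p :=
    (hg.continuous_fderiv one_ne_zero).norm.rpow_const fun _ => .inr hp.le
  have hφs : HasCompactSupport fun x => ‖fderiv ℝ g x‖ ^ p :=
    (hgs.fderiv ℝ).comp_left (g := fun t => ‖t‖ ^ p) (by simp [hp.ne'])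
  obtain ⟨δ, hδ, H⟩ := Metric.uniformContinuous_iff.1
    (hφs.uniformContinuous_of_continuous hφ) ε hε
  refine ⟨min (δ / 2) 1, by positivity, fun z y hy => ?_⟩
  have hy1 := hy.trans (min_le_left _ _)
  have hy2 := hy.trans (min_le_right _ _)
  by_cases hz : z ∈ Metric.cthickening 1 (tsupport g)
  · rw [Set.indicator_of_mem hz]
    have hbound : ∀ x ∈ Metric.ball z δ,
        ‖fderiv ℝ g x‖ ≤ (‖fderiv ℝ g z‖ ^ p + ε) ^ (1 / p) := by
      intro x hx
      have h1 := H hx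
      rw [Real.dist_eq] at h1
      have h2 := (abs_lt.1 h1).2
      calc ‖fderiv ℝ g x‖ = (‖fderiv ℝ g x‖ ^ p) ^ (1 / p) := by
            rw [← Real.rpow_mul (norm_nonneg _), mul_one_div_cancel hp.ne', Real.rpow_one]
        _ ≤ _ := by gcongr; linarith
    have h3 := (convex_ball z δ).norm_image_sub_le_of_norm_fderiv_le (𝕜 := ℝ) (f := g)
      (fun x _ => (hg.differentiable one_ne_zero).differentiableAt) hbound
      (Metric.mem_ball_self hδ) (y := z - y) (by simp; linarith)
    have h4 : ‖z - y - z‖ = ‖y‖ := by simp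
    rw [h4] at h3
    linarith [(le_abs_self _).trans h3]
  · have h0 : g (z - y) = 0 := by
      refine image_eq_zero_of_notMem_tsupport fun hmem => hz ?_
      exact Metric.mem_cthickening_of_dist_le z (z - y) 1 _ hmem (by simpa [dist_eq_norm])
    have h1 : g z = 0 := by
      refine image_eq_zero_of_notMem_tsupport fun hmem => hz ?_
      exact Metric.self_subset_cthickening _ hmem
    rw [h0, h1, Set.indicator_of_notMem hz]
    positivity

theorem integral_exp_neg_norm_rpow {n : ℕ} (hn : 1 ≤ n) {q : ℝ} (hq : 0 < q) :
    ∫ y : EuclideanSpace ℝ (Fin n), Real.exp (-‖y‖ ^ q) =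
      Real.pi ^ ((n : ℝ) / 2) * Real.Gamma (n / q + 1) / Real.Gamma (n / 2 + 1) := by
  have : Nonempty (Fin n) := ⟨⟨0, hn⟩⟩
  have h := measure_unitBall_eq_integral_div_gamma
    (volume : Measure (EuclideanSpace ℝ (Fin n))) hq
  have hΓq : 0 < Real.Gamma (n / q + 1) := Real.Gamma_pos_of_pos (by positivity)
  have hΓ2 : 0 < Real.Gamma ((n : ℝ) / 2 + 1) := Real.Gamma_pos_of_pos (by positivity)
  have hI : 0 ≤ ∫ y : EuclideanSpace ℝ (Fin n), Real.exp (-‖y‖ ^ q) :=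
    integral_nonneg fun _ => (Real.exp_pos _).le
  rw [EuclideanSpace.volume_ball, finrank_euclideanSpace_fin, Fintype.card_fin, ENNReal.ofReal_one,
    one_pow, one_mul, ENNReal.ofReal_eq_ofReal_iff (by positivity) (by positivity)] at h
  have hpi : √Real.pi ^ n = Real.pi ^ ((n : ℝ) / 2) := by
    rw [Real.sqrt_eq_rpow, ← Real.rpow_natCast, ← Real.rpow_mul Real.pi_pos.le]
    ring_nf
  rw [hpi] at h
  field_simp at h ⊢
  linarith

theorem integrable_exp_neg_norm_rpow {n : ℕ} (hn : 1 ≤ n) {q : ℝ} (hq : 0 < q) :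
    Integrable fun y : EuclideanSpace ℝ (Fin n) => Real.exp (-‖y‖ ^ q) := by
  refine .of_integral_ne_zero ?_
  rw [integral_exp_neg_norm_rpow hn hq]
  have hΓq : 0 < Real.Gamma (n / q + 1) := Real.Gamma_pos_of_pos (by positivity)
  have hΓ2 : 0 < Real.Gamma ((n : ℝ) / 2 + 1) := Real.Gamma_pos_of_pos (by positivity)
  positivity

theorem exp_neg_mul_norm_rpow_eq {E : Type*} [NormedAddCommGroup E] [NormedSpace ℝ E] {q C : ℝ}
    (hq : 0 < q) (hC : 0 < C) (y : E) :
    Real.exp (-(C * ‖y‖ ^ q)) = Real.exp (-‖C ^ (1 / q) • y‖ ^ q) := by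
  rw [norm_smul, Real.norm_of_nonneg (by positivity), Real.mul_rpow (by positivity) (norm_nonneg _),
    ← Real.rpow_mul hC.le, one_div_mul_cancel hq.ne', Real.rpow_one]

theorem integrable_exp_neg_mul_norm_rpow {n : ℕ} (hn : 1 ≤ n) {q C : ℝ} (hq : 0 < q) (hC : 0 < C) :
    Integrable fun y : EuclideanSpace ℝ (Fin n) => Real.exp (-(C * ‖y‖ ^ q)) := by
  simp only [exp_neg_mul_norm_rpow_eq hq hC]
  exact (integrable_exp_neg_norm_rpow hn hq).comp_smul (Real.rpow_pos_of_pos hC _).ne'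

theorem log_integral_exp_neg_mul_norm_rpow {n : ℕ} (hn : 1 ≤ n) {q C : ℝ} (hq : 0 < q)
    (hC : 0 < C) :
    Real.log (∫ y : EuclideanSpace ℝ (Fin n), Real.exp (-(C * ‖y‖ ^ q))) =
      n / 2 * Real.log Real.pi + Real.log (Real.Gamma (n / q + 1)) -
        Real.log (Real.Gamma (n / 2 + 1)) - n / q * Real.log C := by
  have hΓq : 0 < Real.Gamma (n / q + 1) := Real.Gamma_pos_of_pos (by positivity)
  have hΓ2 : 0 < Real.Gamma ((n : ℝ) / 2 + 1) := Real.Gamma_pos_of_pos (by positivity)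
  have hCq : 0 < C ^ (1 / q) := Real.rpow_pos_of_pos hC _
  simp only [exp_neg_mul_norm_rpow_eq hq hC]
  rw [Measure.integral_comp_smul (volume : Measure (EuclideanSpace ℝ (Fin n)))
    (fun y => Real.exp (-‖y‖ ^ q)), integral_exp_neg_norm_rpow hn hq, finrank_euclideanSpace_fin,
    smul_eq_mul, abs_of_pos (by positivity), Real.log_mul (by positivity) (by positivity),
    Real.log_inv, Real.log_pow, Real.log_rpow hC, Real.log_div (by positivity) (by positivity),
    Real.log_mul (by positivity) (by positivity), Real.log_rpow Real.pi_pos]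
  ring

open Filter Topology in
theorem entropy_le_of_hasCompactSupport {n : ℕ} (hn : 1 ≤ n) {p q : ℝ} (hpq : p.HolderConjugate q)
    {g : EuclideanSpace ℝ (Fin n) → ℝ} (hg : ContDiff ℝ 1 g) (hgs : HasCompactSupport g)
    (hg0 : ∀ x, 0 ≤ g x) (hA : 0 < ∫ x, g x ^ p) {c : ℝ} (hc : 0 < c) :
    (∫ x, g x ^ p * Real.log (g x ^ p)) / (∫ x, g x ^ p) +
      Real.log (∫ y : EuclideanSpace ℝ (Fin n),
        Real.exp (-((p - 1) * c ^ (1 - q) * ‖y‖ ^ q))) + n ≤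
      Real.log (∫ x, g x ^ p) + (c * ∫ x, ‖fderiv ℝ g x‖ ^ p) / ∫ x, g x ^ p := by
  have hp := hpq.pos
  have hq := hpq.symm.pos
  have hC : 0 < (p - 1) * c ^ (1 - q) := mul_pos hpq.sub_one_pos (Real.rpow_pos_of_pos hc _)
  set k : EuclideanSpace ℝ (Fin n) → ℝ :=
    fun y => Real.exp (-((p - 1) * c ^ (1 - q) * ‖y‖ ^ q))
  have hki : Integrable k := integrable_exp_neg_mul_norm_rpow hn hq hC
  have hkpos : 0 < ∫ y, k y := by
    refine (integral_pos_iff_support_of_nonneg (fun _ => (Real.exp_pos _).le) hki).2 ?_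
    have : Function.support k = Set.univ := by
      ext y; simp [k, (Real.exp_pos _).ne']
    rw [this]
    exact isOpen_univ.measure_pos _ ⟨0, trivial⟩
  set A := ∫ x, g x ^ p
  set D := ∫ x, ‖fderiv ℝ g x‖ ^ p with hD
  set B := Metric.cthickening 1 (tsupport g)
  have hBc : IsCompact B := hgs.isCompact.cthickening
  have hφ : Continuous fun x => ‖fderiv ℝ g x‖ ^ p :=
    (hg.continuous_fderiv one_ne_zero).norm.rpow_const fun _ => .inr hp.le
  have hφi : Integrable fun x => ‖fderiv ℝ g x‖ ^ p :=
    hφ.integrable_of_hasCompactSupport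
      ((hgs.fderiv ℝ).comp_left (g := fun t => ‖t‖ ^ p) (by simp [hp.ne']))
  have hstep : ∀ ρ > 0, ∀ ε > 0,
      (∫ x, g x ^ p * Real.log (g x ^ p)) / A +
        Real.log (∫ y in Metric.closedBall 0 ρ, k y) + n ≤
      Real.log A + (c * (D + volume.real B * ε)) / A := by
    intro ρ hρ ε hε
    obtain ⟨δ, hδ, hslope⟩ := hgs.exists_local_slope hg hp hε
    set w := fun z => ‖fderiv ℝ g z‖ ^ p + B.indicator (fun _ => ε) z
    have hBi : Integrable (B.indicator fun _ => ε) :=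
      (integrableOn_const hBc.measure_lt_top.ne).integrable_indicator hBc.measurableSet
    have hwint : ∫ z, w z = D + volume.real B * ε := by
      rw [integral_add hφi hBi, integral_indicator hBc.measurableSet, setIntegral_const,
        smul_eq_mul]
    have hlim : Tendsto (fun l : ℝ => (∫ x, g x ^ p * Real.log (g x ^ p)) / A +
        Real.log (∫ y in Metric.closedBall 0 ρ, k y) + n * (1 - l)) (𝓝[>] 0)
        (𝓝 ((∫ x, g x ^ p * Real.log (g x ^ p)) / A +
          Real.log (∫ y in Metric.closedBall 0 ρ, k y) + n * (1 - 0))) :=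
      (Continuous.tendsto (by fun_prop) 0).mono_left nhdsWithin_le_nhds
    rw [sub_zero, mul_one] at hlim
    refine le_of_tendsto hlim ?_
    have hm : 0 < min (δ / ρ) 1 := by positivity
    filter_upwards [Ioo_mem_nhdsGT hm] with l hl
    have h1 : l * ρ < δ := (lt_div_iff₀ hρ).1 (hl.2.trans_le (min_le_left _ _))
    rw [← hwint]
    exact entropy_le_of_local_slope hpq hg.continuous hgs hg0
      (hφ.measurable.add (measurable_const.indicator hBc.measurableSet)) (hφi.add hBi)
      (fun z => add_nonneg (by positivity) (Set.indicator_nonneg (fun _ _ => hε.le) z)) hA hc hρ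
      hl.1 (hl.2.trans_le (min_le_right _ _)) fun z y hy => hslope z y (hy.trans h1.le)
  have hstep' : ∀ ρ > 0, (∫ x, g x ^ p * Real.log (g x ^ p)) / A +
        Real.log (∫ y in Metric.closedBall 0 ρ, k y) + n ≤ Real.log A + (c * D) / A := by
    intro ρ hρ
    have hlim : Tendsto (fun ε : ℝ => Real.log A + (c * (D + volume.real B * ε)) / A) (𝓝[>] 0)
        (𝓝 (Real.log A + (c * (D + volume.real B * 0)) / A)) :=
      (Continuous.tendsto (by fun_prop) 0).mono_left nhdsWithin_le_nhds
    rw [mul_zero, add_zero] at hlim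
    exact ge_of_tendsto hlim (eventually_mem_nhdsWithin.mono fun ε hε => hstep ρ hρ ε hε)
  have hZlim : Tendsto (fun m : ℕ => ∫ y in Metric.closedBall 0 (m : ℝ), k y) atTop
      (𝓝 (∫ y, k y)) := by
    have := tendsto_setIntegral_of_monotone (μ := volume) (f := k)
      (s := fun m : ℕ => Metric.closedBall (0 : EuclideanSpace ℝ (Fin n)) m)
      (fun m => Metric.isClosed_closedBall.measurableSet)
      (fun i j hij => Metric.closedBall_subset_closedBall (by exact_mod_cast hij)) hki.integrableOn
    rwa [Metric.iUnion_closedBall_nat, setIntegral_univ] at this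
  refine le_of_tendsto ((((Real.continuousAt_log hkpos.ne').tendsto.comp
    hZlim).const_add _).add_const _)
    ((eventually_gt_atTop 0).mono fun m hm => hstep' m (by exact_mod_cast hm))
theorem Real.add_rpow_le_mul_rpow_add_rpow {a b p : ℝ} (ha : 0 ≤ a) (hb : 0 ≤ b) (hp : 1 ≤ p) :
    (a + b) ^ p ≤ 2 ^ (p - 1) * (a ^ p + b ^ p) := by
  lift a to NNReal using ha
  lift b to NNReal using hb
  exact_mod_cast NNReal.rpow_add_le_mul_rpow_add_rpow a b hp

theorem abs_mul_log_mul_le {s f : ℝ} (hs0 : 0 ≤ s) (hs1 : s ≤ 1) (hf : 0 ≤ f) :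
    |s * f * Real.log (s * f)| ≤ |f * Real.log f| + f := by
  rcases hs0.eq_or_lt with rfl | hs
  · simp only [zero_mul, abs_zero]; positivity
  rcases hf.eq_or_lt with rfl | hf
  · simp
  have h1 := (Real.abs_log_mul_self_lt s hs hs1).le
  calc |s * f * Real.log (s * f)| = |s * (f * Real.log f) + f * (Real.log s * s)| := by
        rw [Real.log_mul hs.ne' hf.ne']; ring_nf
    _ ≤ s * |f * Real.log f| + f * |Real.log s * s| := by
        refine (abs_add_le _ _).trans (le_of_eq ?_)
        rw [abs_mul s, abs_mul f (_ * _), abs_of_pos hs, abs_of_pos hf]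
    _ ≤ 1 * |f * Real.log f| + f * 1 := by gcongr
    _ = _ := by ring

theorem norm_fderiv_bump_mul_le {E : Type*} [NormedAddCommGroup E] [NormedSpace ℝ E]
    {ψ g : E → ℝ} (hψ : ContDiff ℝ 1 ψ) (hg : ContDiff ℝ 1 g) (hψ0 : ∀ x, 0 ≤ ψ x)
    (hψ1 : ∀ x, ψ x ≤ 1) (hg0 : ∀ x, 0 ≤ g x) {L : ℝ} (hL : ∀ x, ‖fderiv ℝ ψ x‖ ≤ L) {t : ℝ}
    (ht : 0 ≤ t) (x : E) :
    ‖fderiv ℝ (fun x => ψ (t • x) * g x) x‖ ≤ ‖fderiv ℝ g x‖ + t * L * g x := by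
  have h1 : HasFDerivAt (fun x => ψ (t • x)) (t • fderiv ℝ ψ (t • x)) x := by
    have h2 : HasFDerivAt (fun x : E => t • x) (t • ContinuousLinearMap.id ℝ E) x :=
      (hasFDerivAt_id x).const_smul t
    have h3 := ((hψ.differentiable one_ne_zero) (t • x)).hasFDerivAt.comp x h2
    have h4 : t • fderiv ℝ ψ (t • x) =
        fderiv ℝ ψ (t • x) ∘L (t • ContinuousLinearMap.id ℝ E) := by
      ext; simp
    rw [h4]
    exact h3
  have h2 : HasFDerivAt (fun x => ψ (t • x) * g x) _ x :=
    h1.mul ((hg.differentiable one_ne_zero) x).hasFDerivAt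
  rw [h2.fderiv]
  calc ‖ψ (t • x) • fderiv ℝ g x + g x • t • fderiv ℝ ψ (t • x)‖
      ≤ ψ (t • x) * ‖fderiv ℝ g x‖ + g x * (t * ‖fderiv ℝ ψ (t • x)‖) := by
        refine (norm_add_le _ _).trans (le_of_eq ?_)
        rw [norm_smul, norm_smul, norm_smul, Real.norm_of_nonneg (hψ0 _),
          Real.norm_of_nonneg (hg0 _), Real.norm_of_nonneg ht]
    _ ≤ 1 * ‖fderiv ℝ g x‖ + g x * (t * L) := by
        have := hg0 x
        gcongr
        · exact hψ1 _
        · exact hL _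
    _ = _ := by ring

open Filter Topology in
theorem entropy_le {n : ℕ} (hn : 1 ≤ n) {p q : ℝ} (hpq : p.HolderConjugate q)
    {g : EuclideanSpace ℝ (Fin n) → ℝ} (hg : ContDiff ℝ 1 g) (hg0 : ∀ x, 0 ≤ g x)
    (hnorm : ∫ x, g x ^ p = 1) (hgrad : Integrable (fun x => ‖fderiv ℝ g x‖ ^ p))
    (hent : Integrable (fun x => g x ^ p * Real.log (g x ^ p))) {c : ℝ} (hc : 0 < c) :
    (∫ x, g x ^ p * Real.log (g x ^ p)) +
      Real.log (∫ y : EuclideanSpace ℝ (Fin n),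
        Real.exp (-((p - 1) * c ^ (1 - q) * ‖y‖ ^ q))) + n ≤
      c * ∫ x, ‖fderiv ℝ g x‖ ^ p := by
  have hp := hpq.pos
  have hgi : Integrable fun x => g x ^ p := .of_integral_ne_zero (by simp [hnorm])
  have hgc := hg.continuous
  have hdc := hg.continuous_fderiv one_ne_zero
  let ψ : ContDiffBump (0 : EuclideanSpace ℝ (Fin n)) := ⟨1, 2, one_pos, one_lt_two⟩
  have hψ : ContDiff ℝ 1 ψ := ψ.contDiff
  obtain ⟨L, hL⟩ := (hψ.continuous_fderiv one_ne_zero).bounded_above_of_compact_support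
    (ψ.hasCompactSupport.fderiv ℝ)
  have hL0 : 0 ≤ L := (norm_nonneg _).trans (hL 0)
  let t : ℕ → ℝ := fun k => 1 / ((k : ℝ) + 1)
  have ht0 : ∀ k, 0 < t k := fun k => Nat.one_div_pos_of_nat
  have ht1 : ∀ k, t k ≤ 1 := fun k => by
    have : (0 : ℝ) ≤ k := k.cast_nonneg
    exact (div_le_one (by positivity)).2 (by linarith)
  have ht : Tendsto t atTop (𝓝 0) := tendsto_one_div_add_atTop_nhds_zero_nat
  let G : ℕ → EuclideanSpace ℝ (Fin n) → ℝ := fun k x => ψ (t k • x) * g x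
  have hG : ∀ k, ContDiff ℝ 1 (G k) := fun k => (hψ.comp (contDiff_const_smul (t k))).mul hg
  have hGs : ∀ k, HasCompactSupport (G k) := fun k =>
    (ψ.hasCompactSupport.comp_smul (ht0 k).ne').mul_right
  have hG0 : ∀ k x, 0 ≤ G k x := fun k x => mul_nonneg ψ.nonneg (hg0 x)
  have hs0 : ∀ k x, 0 ≤ ψ (t k • x) ^ p := fun k x => Real.rpow_nonneg ψ.nonneg p
  have hs1 : ∀ k x, ψ (t k • x) ^ p ≤ 1 := fun k x =>
    Real.rpow_le_one ψ.nonneg ψ.le_one hp.le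
  have hGp : ∀ k x, G k x ^ p = ψ (t k • x) ^ p * g x ^ p := fun k x =>
    Real.mul_rpow ψ.nonneg (hg0 x)
  have hGlim : ∀ x, Tendsto (fun k => G k x ^ p) atTop (𝓝 (g x ^ p)) := by
    intro x
    have h1 : Tendsto (fun k => t k • x) atTop (𝓝 0) := by simpa using ht.smul_const x
    have h2 : Tendsto (fun k => ψ (t k • x)) atTop (𝓝 1) := by
      have := (ψ.continuous.tendsto 0).comp h1
      rwa [ψ.one_of_mem_closedBall (Metric.mem_closedBall_self ψ.rIn_pos.le)] at this
    have h3 := (h2.mul_const (g x)).rpow_const (p := p) (.inr hp.le)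
    rwa [one_mul] at h3
  have hAlim : Tendsto (fun k => ∫ x, G k x ^ p) atTop (𝓝 1) := by
    rw [← hnorm]
    refine tendsto_integral_of_dominated_convergence (fun x => g x ^ p)
      (fun k => ((hG k).continuous.rpow_const fun _ => .inr hp.le).aestronglyMeasurable) hgi
      (fun k => .of_forall fun x => ?_) (.of_forall hGlim)
    rw [Real.norm_of_nonneg (Real.rpow_nonneg (hG0 k x) p), hGp]
    exact mul_le_of_le_one_left (Real.rpow_nonneg (hg0 x) p) (hs1 k x)
  have hElim : Tendsto (fun k => ∫ x, G k x ^ p * Real.log (G k x ^ p)) atTop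
      (𝓝 (∫ x, g x ^ p * Real.log (g x ^ p))) := by
    refine tendsto_integral_of_dominated_convergence
      (fun x => |g x ^ p * Real.log (g x ^ p)| + g x ^ p)
      (fun k => (Real.continuous_mul_log.comp
        ((hG k).continuous.rpow_const fun _ => .inr hp.le)).aestronglyMeasurable)
      (hent.abs.add hgi) (fun k => .of_forall fun x => ?_)
      (.of_forall fun x => (Real.continuous_mul_log.tendsto _).comp (hGlim x))
    rw [Real.norm_eq_abs, hGp]
    exact abs_mul_log_mul_le (hs0 k x) (hs1 k x) (Real.rpow_nonneg (hg0 x) p)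
  have hbase : ∀ s x, 0 ≤ s → 0 ≤ ‖fderiv ℝ g x‖ + s * L * g x := fun s x hs => by
    have := hg0 x
    positivity
  have hdom : Integrable fun x => (‖fderiv ℝ g x‖ + 1 * L * g x) ^ p := by
    refine ((hgrad.add (hgi.const_mul (L ^ p))).const_mul (2 ^ (p - 1))).mono'
      (Continuous.aestronglyMeasurable (by
        refine Continuous.rpow_const (by fun_prop) fun _ => .inr hp.le)) (.of_forall fun x => ?_)
    rw [Real.norm_of_nonneg (Real.rpow_nonneg (hbase 1 x zero_le_one) p)]
    refine (Real.add_rpow_le_mul_rpow_add_rpow (norm_nonneg _)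
      (mul_nonneg (by positivity) (hg0 x)) hpq.lt.le).trans (le_of_eq ?_)
    rw [one_mul, Real.mul_rpow hL0 (hg0 x)]
    rfl
  have hslope_le : ∀ k x, (‖fderiv ℝ g x‖ + t k * L * g x) ^ p ≤
      (‖fderiv ℝ g x‖ + 1 * L * g x) ^ p := fun k x => by
    have := hg0 x
    exact Real.rpow_le_rpow (hbase _ x (ht0 k).le) (by gcongr; exact ht1 k) hp.le
  have hslope_meas : ∀ k, AEStronglyMeasurable fun x => (‖fderiv ℝ g x‖ + t k * L * g x) ^ p :=
    fun k => Continuous.aestronglyMeasurable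
      (Continuous.rpow_const (by fun_prop) fun _ => .inr hp.le)
  have hslope_norm : ∀ k x, ‖(‖fderiv ℝ g x‖ + t k * L * g x) ^ p‖ ≤
      (‖fderiv ℝ g x‖ + 1 * L * g x) ^ p := fun k x => by
    rw [Real.norm_of_nonneg (Real.rpow_nonneg (hbase _ x (ht0 k).le) p)]
    exact hslope_le k x
  have hDlim : Tendsto (fun k => ∫ x, (‖fderiv ℝ g x‖ + t k * L * g x) ^ p) atTop
      (𝓝 (∫ x, ‖fderiv ℝ g x‖ ^ p)) := by
    refine tendsto_integral_of_dominated_convergence _ hslope_meas hdom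
      (fun k => .of_forall (hslope_norm k)) (.of_forall fun x => ?_)
    have h1 := (((ht.mul_const L).mul_const (g x)).const_add ‖fderiv ℝ g x‖).rpow_const
      (p := p) (.inr hp.le)
    simpa using h1
  have hDle : ∀ k, ∫ x, ‖fderiv ℝ (G k) x‖ ^ p ≤ ∫ x, (‖fderiv ℝ g x‖ + t k * L * g x) ^ p := by
    intro k
    refine integral_mono_of_nonneg (.of_forall fun x => by positivity)
      (hdom.mono' (hslope_meas k) (.of_forall (hslope_norm k))) (.of_forall fun x => ?_)
    exact Real.rpow_le_rpow (norm_nonneg _) (norm_fderiv_bump_mul_le hψ hg (fun _ => ψ.nonneg)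
      (fun _ => ψ.le_one) hg0 hL (ht0 k).le x) hp.le
  have hlhs := ((hElim.div hAlim one_ne_zero).add_const (Real.log
    (∫ y : EuclideanSpace ℝ (Fin n), Real.exp (-((p - 1) * c ^ (1 - q) * ‖y‖ ^ q))))).add_const
      (n : ℝ)
  have hrhs := ((Real.continuousAt_log one_ne_zero).tendsto.comp hAlim).add
    ((hDlim.const_mul c).div hAlim one_ne_zero)
  rw [div_one] at hlhs
  rw [Real.log_one, zero_add, div_one] at hrhs
  refine le_of_tendsto_of_tendsto hlhs hrhs ?_
  filter_upwards [hAlim.eventually (lt_mem_nhds zero_lt_one)] with k hk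
  refine (entropy_le_of_hasCompactSupport hn hpq (hG k) (hGs k) (hG0 k) hk hc).trans ?_
  simp only [Function.comp_apply, Pi.div_apply]
  have := hDle k
  gcongr

theorem log_gammaConst {n : ℕ} (hn : 1 ≤ n) {p q : ℝ} (hpq : p.HolderConjugate q) :
    Real.log (gammaConst n p q) = Real.log n + (p - 1) * (Real.log q + 1) +
      p / 2 * Real.log Real.pi -
        p / n * (Real.log (Real.Gamma (n / 2 + 1)) - Real.log (Real.Gamma (n / q + 1))) := by
  have hq := hpq.symm.pos
  have hn0 : (0 : ℝ) < n := by exact_mod_cast hn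
  have hΓq : 0 < Real.Gamma (n / q + 1) := Real.Gamma_pos_of_pos (by positivity)
  have hΓ2 : 0 < Real.Gamma ((n : ℝ) / 2 + 1) := Real.Gamma_pos_of_pos (by positivity)
  have hπ := Real.pi_pos
  rw [gammaConst, Real.log_mul (by positivity) (by positivity),
    Real.log_mul (by positivity) (by positivity), Real.log_mul (by positivity) (by positivity),
    Real.log_rpow (by positivity), Real.log_rpow hπ, Real.log_rpow (by positivity),
    Real.log_mul hq.ne' (Real.exp_pos 1).ne', Real.log_exp, Real.log_div hΓ2.ne' hΓq.ne']
  ring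

theorem gammaConst_pos {n : ℕ} (hn : 1 ≤ n) {p q : ℝ} (hq : 0 < q) : 0 < gammaConst n p q := by
  have hn0 : (0 : ℝ) < n := by exact_mod_cast hn
  have hΓq : 0 < Real.Gamma (n / q + 1) := Real.Gamma_pos_of_pos (by positivity)
  have hΓ2 : 0 < Real.Gamma ((n : ℝ) / 2 + 1) := Real.Gamma_pos_of_pos (by positivity)
  have hπ := Real.pi_pos
  rw [gammaConst]
  positivity

theorem Lp_logarithmic_Sobolev (n : ℕ) (hn : 1 ≤ n) (p q : ℝ) (hp : 1 < p)
    (hq : q = p / (p - 1))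
    (g : EuclideanSpace ℝ (Fin n) → ℝ) (hg : ContDiff ℝ 1 g) (hgpos : ∀ x, 0 < g x)
    (hnorm : ∫ x, g x ^ p = 1)
    (hgrad : Integrable (fun x => ‖fderiv ℝ g x‖ ^ p))
    (hent : Integrable (fun x => g x ^ p * Real.log (g x ^ p))) :
    ∫ x, g x ^ p * Real.log (g x ^ p) ≤
      ((n : ℝ) / p) *
        Real.log (p ^ p * (gammaConst n p q)⁻¹ * ∫ x, ‖fderiv ℝ g x‖ ^ p) := by
  have hpq : p.HolderConjugate q := hq ▸ .conjExponent hp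
  have hp0 := hpq.pos
  have hq0 := hpq.symm.pos
  have hp1 : 0 < p - 1 := sub_pos.2 hp
  have hn0 : (0 : ℝ) < n := by exact_mod_cast hn
  set E := ∫ x, g x ^ p * Real.log (g x ^ p)
  set D := ∫ x, ‖fderiv ℝ g x‖ ^ p
  set K := n / q * Real.log (p - 1) - n / 2 * Real.log Real.pi -
    Real.log (Real.Gamma (n / q + 1)) + Real.log (Real.Gamma (n / 2 + 1)) - n with hK
  have key : ∀ c, 0 < c → E ≤ c * D - n / p * Real.log c + K := by
    intro c hc
    have hcq := Real.rpow_pos_of_pos hc (1 - q)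
    have h1 := entropy_le hn hpq hg (fun x => (hgpos x).le) hnorm hgrad hent hc
    rw [log_integral_exp_neg_mul_norm_rpow hn hq0 (mul_pos hp1 hcq),
      Real.log_mul hp1.ne' hcq.ne', Real.log_rpow hc] at h1
    have h2 : (n : ℝ) / q * (1 - q) = -(n / p) := by
      rw [hq]
      field_simp
      ring
    have h3 : (n : ℝ) / q * (Real.log (p - 1) + (1 - q) * Real.log c) =
        n / q * Real.log (p - 1) - n / p * Real.log c := by
      rw [mul_add, ← mul_assoc, h2]
      ring
    linarith
  rcases (show 0 ≤ D from integral_nonneg fun x => by positivity).eq_or_lt with hD | hD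
  · rw [← hD, mul_zero, Real.log_zero, mul_zero]
    refine (key (Real.exp (p / n * K)) (Real.exp_pos _)).trans (le_of_eq ?_)
    rw [← hD, Real.log_exp]
    field_simp
    ring
  · refine (key (n / (p * D)) (by positivity)).trans (le_of_eq ?_)
    have hlq : Real.log q = Real.log p - Real.log (p - 1) := by
      rw [hq, Real.log_div hp0.ne' hp1.ne']
    have hγ := gammaConst_pos (p := p) hn hq0
    rw [Real.log_mul (by positivity) hD.ne', Real.log_mul (by positivity) (by positivity),
      Real.log_rpow hp0, Real.log_inv, log_gammaConst hn hpq, hlq,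
      Real.log_div hn0.ne' (by positivity), Real.log_mul hp0.ne' hD.ne', hK]
    have h4 : (n : ℝ) / q = n * (p - 1) / p := by
      rw [hq]
      field_simp
    simp only [h4]
    field_simp
    ring
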